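/- Let ω ∈ Ω₊ and y ∈ ℤ. Then either P_{x,ω}[R_y] = 0 for all starting points x ∈ ℤ, or P_{x,ω}[R_y] = 1 for all starting points x ∈ ℤ. -/

import Mathlib

open MeasureTheory Filter Set Topology ProbabilityTheory
open scoped ENNReal ENat

noncomputable section

/-- A cookie environment: `ω z i` is the strength of the `(i+1)`-st cookie at site `z`
(cookies at each site are indexed by `i = 0, 1, 2, …`). -/
abbrev CEnv : Type := ℤ → ℕ → ℝ

/-- `ω` belongs to `Ω₊`, i.e. all cookie strengths lie in `[1/2, 1]`. -/
def IsCookieEnv (ω : CEnv) : Prop := ∀ z i, ω z i ∈ Set.Icc (1/2 : ℝ) 1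

/-- The number of visits of the path `x` to the site `x n` at times `m < n`. -/
def prevVisits (x : ℕ → ℤ) (n : ℕ) : ℕ :=
  ((Finset.range n).filter fun m => x m = x n).card

/-- The probability of the step from `x n` to `x (n+1)` for the multi-excited random
walk: jump to the right with the strength of the bottom remaining cookie at the current
site, to the left with the complementary probability. -/
def stepProb (ω : CEnv) (x : ℕ → ℤ) (n : ℕ) : ℝ :=
  if x (n+1) = x n + 1 then ω (x n) (prevVisits x n)
  else if x (n+1) = x n - 1 then 1 - ω (x n) (prevVisits x n)
  else 0

/-- The probability that the walk started at `x0` follows the path `x` up to time `n`. -/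
def cylProb (ω : CEnv) (x0 : ℤ) (x : ℕ → ℤ) (n : ℕ) : ℝ :=
  (if x 0 = x0 then 1 else 0) * ∏ m ∈ Finset.range n, stepProb ω x m

/-- `P` is the law `P_{x0,ω}` of the multi-excited random walk in the cookie
environment `ω` started at `x0`, characterized by its cylinder probabilities. -/
def IsERWLaw (ω : CEnv) (x0 : ℤ) (P : Measure (ℕ → ℤ)) : Prop :=
  IsProbabilityMeasure P ∧
    ∀ (x : ℕ → ℤ) (n : ℕ),
      P {Y | ∀ m ≤ n, Y m = x m} = ENNReal.ofReal (cylProb ω x0 x n)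

/-- First passage time `T_k`, with value `∞` if `k` is never visited. -/
def T (k : ℤ) (Y : ℕ → ℤ) : ℕ∞ :=
  sInf {t : ℕ∞ | ∃ n : ℕ, (n : ℕ∞) = t ∧ Y n = k}

/-- First passage time of an extended-real level, with the convention
`T_{−∞} = T_{+∞} = ∞`. -/
def Te (k : EReal) (Y : ℕ → ℤ) : ℕ∞ :=
  sInf {t : ℕ∞ | ∃ n : ℕ, (n : ℕ∞) = t ∧ ((Y n : ℝ) : EReal) = k}

/-- `R_k`, the event that the site `k` is visited infinitely often. -/
def Rset (k : ℤ) : Set (ℕ → ℤ) := {Y | ∀ N : ℕ, ∃ n ≥ N, Y n = k}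

/-- The number of visits of `Y` to the site `s` at times `< t`. -/
def visitsBefore (Y : ℕ → ℤ) (s : ℤ) (t : ℕ∞) : ℕ∞ :=
  {m : ℕ | (m : ℕ∞) < t ∧ Y m = s}.encard

/-- `D_t^s`: the total drift stored in the cookies consumed at the site `s`
before time `t` (a time in `ℕ∞`; `t = ∞` gives `D_∞^s`). -/
def driftAt (ω : CEnv) (Y : ℕ → ℤ) (s : ℤ) (t : ℕ∞) : ℝ≥0∞ :=
  ∑' i : ℕ, Set.indicator {i : ℕ | (i : ℕ∞) < visitsBefore Y s t}
    (fun i => ENNReal.ofReal (2 * ω s i - 1)) i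

/-- `D_t`: the total drift consumed before time `t` (at all sites). -/
def Dtot (ω : CEnv) (Y : ℕ → ℤ) (t : ℕ∞) : ℝ≥0∞ := ∑' s : ℤ, driftAt ω Y s t

/-- `D_t^+`: the total drift consumed at nonnegative sites before time `t`. -/
def DtotPos (ω : CEnv) (Y : ℕ → ℤ) (t : ℕ∞) : ℝ≥0∞ := ∑' s : ℕ, driftAt ω Y (s : ℤ) t

/-- `δ^s`: the total drift stored in the cookies at the site `s`. -/
def cookieDrift (ω : CEnv) (s : ℤ) : ℝ≥0∞ := ∑' i : ℕ, ENNReal.ofReal (2 * ω s i - 1)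

/-- The successive times `τ_{k,1}, τ_{k,2}, …` (indexed here from `0`) at which the
walk is at a site `≥ k`. -/
def tauT (k : ℤ) (Y : ℕ → ℤ) : ℕ → ℕ∞
  | 0 => sInf {t : ℕ∞ | ∃ n : ℕ, (n : ℕ∞) = t ∧ k ≤ Y n}
  | m + 1 => sInf {t : ℕ∞ | ∃ n : ℕ, (n : ℕ∞) = t ∧ tauT k Y m < (n : ℕ∞) ∧ k ≤ Y n}

/-- The observed sequence `(X_{τ_{k,m}})_{m ≥ 1}` (indexed here from `0`). -/
def obsSeq (k : ℤ) (Y : ℕ → ℤ) (m : ℕ) : ℤ := Y (tauT k Y m).toNat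

/-- The one-sided shift on sequences. -/
def shiftSeq {α : Type*} (u : ℕ → α) : ℕ → α := fun n => u (n + 1)

/-- The restriction `(ω(x))_{x ≥ 0}` of an environment to the nonnegative sites. -/
def restrictNN (ω : CEnv) : ℕ → ℕ → ℝ := fun x => ω (x : ℤ)

/-- `(ω(x))_{x ≥ 0}` is stationary under `Pr`: its law is invariant under the shift. -/
def IsStationaryEnv (Pr : Measure CEnv) : Prop :=
  MeasurePreserving shiftSeq (Pr.map restrictNN) (Pr.map restrictNN)

/-- `(ω(x))_{x ≥ 0}` is stationary and ergodic under `Pr`. -/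
def IsStatErgEnv (Pr : Measure CEnv) : Prop :=
  Ergodic shiftSeq (Pr.map restrictNN)

/-- The process `ξ_k = ((ω(x+k))_{x≥0}, (X_{τ_{k,m}} − k)_{m≥0})` consisting of the
environment to the right of `k` and the trajectory at sites `≥ k`, recentered at `k`. -/
def xiProc (p : CEnv × (ℕ → ℤ)) (k : ℕ) : (ℕ → ℕ → ℝ) × (ℕ → ℤ) :=
  (fun x : ℕ => p.1 ((x : ℤ) + (k : ℤ)), fun m => obsSeq (k : ℤ) p.2 m - (k : ℤ))

/-- The step encoded by an arrow: `+1` for `true`, `-1` for `false`. -/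
def arrowStep (b : Bool) : ℤ := if b then 1 else -1

/-- The position and the visit counts at time `n` of the walk which starts at `x`, reads its
steps off the arrow stacks `η` and corrects every new position by `r`. -/
def walkState (r : ℤ → ℤ) (x : ℤ) (η : ℤ × ℕ → Bool) : ℕ → ℤ × (ℤ → ℕ)
  | 0 => (x, 0)
  | n + 1 =>
    let S := walkState r x η n
    (r (S.1 + arrowStep (η (S.1, S.2 S.1))), Function.update S.2 S.1 (S.2 S.1 + 1))

/-- The trajectory of the walk driven by the arrow stacks `η`. -/
def walk (r : ℤ → ℤ) (x : ℤ) (η : ℤ × ℕ → Bool) (n : ℕ) : ℤ := (walkState r x η n).1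

lemma walk_zero (r : ℤ → ℤ) (x : ℤ) (η : ℤ × ℕ → Bool) : walk r x η 0 = x := rfl

lemma walkState_snd (r : ℤ → ℤ) (x : ℤ) (η : ℤ × ℕ → Bool) (n : ℕ) (z : ℤ) :
    (walkState r x η n).2 z = ((Finset.range n).filter fun m => walk r x η m = z).card := by
  induction n with
  | zero => simp [walkState]
  | succ n ih =>
    rw [Finset.range_add_one, Finset.filter_insert]
    by_cases h : walk r x η n = z
    · rw [if_pos h, Finset.card_insert_of_notMem (by simp), ← ih]
      have h' : (walkState r x η n).1 = z := h
      simp [walkState, h']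
    · rw [if_neg h, ← ih]
      have h' : z ≠ (walkState r x η n).1 := fun h' => h h'.symm
      simp [walkState, h']

lemma walk_succ (r : ℤ → ℤ) (x : ℤ) (η : ℤ × ℕ → Bool) (n : ℕ) :
    walk r x η (n + 1) =
      r (walk r x η n + arrowStep (η (walk r x η n, prevVisits (walk r x η) n))) := by
  rw [prevVisits, ← walkState_snd]
  rfl

lemma arrowStep_eq (b : Bool) : arrowStep b = 1 ∨ arrowStep b = -1 := by
  cases b <;> simp [arrowStep]

lemma walk_id_succ (x : ℤ) (η : ℤ × ℕ → Bool) (n : ℕ) :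
    walk id x η (n + 1) = walk id x η n + 1 ∨ walk id x η (n + 1) = walk id x η n - 1 := by
  rw [walk_succ, id]
  rcases arrowStep_eq (η (walk id x η n, prevVisits (walk id x η) n)) with h | h <;>
    rw [h] <;> omega

/-- A nearest-neighbor path. -/
def IsNNPath (f : ℕ → ℤ) : Prop := ∀ n, f (n + 1) = f n + 1 ∨ f (n + 1) = f n - 1

/-- A path which is unbounded from above. -/
def UnboundedPath (f : ℕ → ℤ) : Prop := ∀ m : ℤ, ∃ n, m ≤ f n

lemma isNNPath_walk (x : ℤ) (η : ℤ × ℕ → Bool) : IsNNPath (walk id x η) := walk_id_succ x η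

lemma IsNNPath.le_add {f : ℕ → ℤ} (hf : IsNNPath f) (n : ℕ) : f n ≤ f 0 + n := by
  induction n with
  | zero => simp
  | succ n ih => have := hf n; push_cast; omega

lemma IsNNPath.frequently_ge {f : ℕ → ℤ} (hf : IsNNPath f) (hu : UnboundedPath f) (m : ℤ) (N : ℕ) :
    ∃ n ≥ N, m ≤ f n := by
  obtain ⟨n, hn⟩ := hu (max m (f 0 + N))
  have := hf.le_add n
  exact ⟨n, by omega, by omega⟩

lemma IsNNPath.exists_eq {f : ℕ → ℤ} (hf : IsNNPath f) {a b : ℕ} {m : ℤ} (hab : a ≤ b)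
    (ha : f a ≤ m) (hb : m ≤ f b) : ∃ c, a ≤ c ∧ c ≤ b ∧ f c = m := by
  induction b, hab using Nat.le_induction with
  | base => exact ⟨a, le_rfl, le_rfl, by omega⟩
  | succ b hab ih =>
    by_cases h : m ≤ f b
    · obtain ⟨c, h1, h2, h3⟩ := ih h
      exact ⟨c, h1, by omega, h3⟩
    · have := hf b
      exact ⟨b + 1, by omega, le_rfl, by omega⟩

lemma IsNNPath.exists_downcrossing {f : ℕ → ℤ} (hf : IsNNPath f) {a b : ℕ} {z : ℤ} (hab : a ≤ b)
    (ha : z ≤ f a) (hb : f b ≤ z - 1) : ∃ c, a ≤ c ∧ f c = z ∧ f (c + 1) = z - 1 := by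
  induction b, hab using Nat.le_induction with
  | base => omega
  | succ b hab ih =>
    by_cases h : f b ≤ z - 1
    · exact ih h
    · have := hf b
      exact ⟨b, hab, by omega, by omega⟩

lemma IsNNPath.rset_mono {f : ℕ → ℤ} (hf : IsNNPath f) (hu : UnboundedPath f) {y m : ℤ}
    (hym : y ≤ m) (h : f ∈ Rset y) : f ∈ Rset m := by
  intro N
  obtain ⟨a, ha, hay⟩ := h N
  obtain ⟨b, hb, hbm⟩ := hf.frequently_ge hu m a
  obtain ⟨c, hc, -, hcm⟩ := hf.exists_eq hb (hay.trans_le hym) hbm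
  exact ⟨c, ha.trans hc, hcm⟩

lemma infinite_of_mem_rset {f : ℕ → ℤ} {z : ℤ} (h : f ∈ Rset z) :
    (Set.ofPred fun n => f n = z).Infinite := by
  rw [Set.infinite_iff_exists_gt]
  intro N
  obtain ⟨n, hn, hz⟩ := h (N + 1)
  exact ⟨n, hz, by omega⟩

lemma prevVisits_eq_count (f : ℕ → ℤ) (n : ℕ) :
    prevVisits f n = Nat.count (fun m => f m = f n) n := by
  rw [Nat.count_eq_card_filter_range]
  rfl

/-- A walk which visits `z` infinitely often uses up the whole arrow stack at `z`. -/
lemma walk_mem_rset_pred {x z : ℤ} {η : ℤ × ℕ → Bool} (h : walk id x η ∈ Rset z)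
    (hη : ∃ᶠ i in atTop, η (z, i) = false) : walk id x η ∈ Rset (z - 1) := by
  have hinf := infinite_of_mem_rset h
  intro N
  obtain ⟨i, hi, hiz⟩ := (Filter.frequently_atTop.1 hη) N
  set t := Nat.nth (fun n => walk id x η n = z) i with ht
  have htz : walk id x η t = z := Nat.nth_mem_of_infinite hinf i
  have hit : i ≤ t := (Nat.nth_strictMono hinf).id_le i
  refine ⟨t + 1, by omega, ?_⟩
  have hp : prevVisits (walk id x η) t = i := by
    rw [prevVisits_eq_count, htz, ht, Nat.count_nth_of_infinite hinf]
  rw [walk_succ, hp, htz, hiz]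
  simp [arrowStep, sub_eq_add_neg]

lemma frequently_false_of_mem_rset_pred {x z : ℤ} {η : ℤ × ℕ → Bool}
    (hu : UnboundedPath (walk id x η)) (h : walk id x η ∈ Rset (z - 1)) :
    ∃ᶠ i in atTop, η (z, i) = false := by
  have hf := isNNPath_walk x η
  have hinf := infinite_of_mem_rset (hf.rset_mono hu (show z - 1 ≤ z by omega) h)
  rw [Filter.frequently_atTop]
  intro N
  obtain ⟨a, ha, haz⟩ := hf.frequently_ge hu z (Nat.nth (fun n => walk id x η n = z) N)
  obtain ⟨b, hb, hbz⟩ := h a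
  obtain ⟨c, hc, hcz, hcz'⟩ := hf.exists_downcrossing hb haz hbz.le
  refine ⟨prevVisits (walk id x η) c, ?_, ?_⟩
  · rw [prevVisits_eq_count, hcz]
    calc N = Nat.count (fun n => walk id x η n = z) (Nat.nth (fun n => walk id x η n = z) N) :=
          (Nat.count_nth_of_infinite hinf N).symm
      _ ≤ _ := Nat.count_monotone _ (ha.trans hc)
  · rw [walk_succ, hcz, id] at hcz'
    by_contra hne
    rw [Bool.not_eq_false] at hne
    rw [hne] at hcz'
    simp [arrowStep] at hcz'
    omega

/-- The walk observed at the sites `≥ m` is the walk reflected at `m`. -/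
lemma walk_max_eq_nth {x m : ℤ} {η : ℤ × ℕ → Bool} (hx : x ≤ m)
    (hu : UnboundedPath (walk id x η)) (k : ℕ) :
    walk (max m) m η k = walk id x η (Nat.nth (fun n => m ≤ walk id x η n) k) := by
  have hf := isNNPath_walk x η
  set A := walk id x η with hA
  set p : ℕ → Prop := fun n => m ≤ A n with hp
  have hinf : (Set.ofPred p).Infinite := by
    rw [Set.infinite_iff_exists_gt]
    intro N
    obtain ⟨n, hn, hz⟩ := hf.frequently_ge hu m (N + 1)
    exact ⟨n, hz, by omega⟩
  have hmono := Nat.nth_strictMono hinf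
  have hmem : ∀ i, m ≤ A (Nat.nth p i) := Nat.nth_mem_of_infinite hinf
  have hlow : ∀ i n, (∀ j < i, Nat.nth p j < n) → n < Nat.nth p i → A n < m := by
    intro i n h1 h2
    by_contra! h3
    exact absurd ((Nat.isLeast_nth_of_infinite hinf i).2 ⟨h3, h1⟩) (by omega)
  induction k using Nat.strong_induction_on with
  | _ k ih =>
  rcases k with _ | k
  · rw [walk_zero]
    rcases hk : Nat.nth p 0 with _ | t
    · have h0 := hmem 0
      rw [hk] at h0
      have : A 0 = x := rfl
      omega
    · have h0 := hmem 0
      have h1 := hlow 0 t (by simp) (by omega)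
      have := hf t
      rw [hk] at h0
      omega
  · have hk := ih k (by omega)
    have hcount : prevVisits (walk (max m) m η) k = prevVisits A (Nat.nth p k) := by
      unfold prevVisits
      rw [hk]
      refine Finset.card_bij (fun j _ => Nat.nth p j) ?_ ?_ ?_
      · intro j hj
        simp only [Finset.mem_filter, Finset.mem_range] at hj ⊢
        exact ⟨hmono hj.1, by rw [← ih j (by omega), hj.2]⟩
      · intro i _ j _ hij
        exact hmono.injective hij
      · intro n hn
        simp only [Finset.mem_filter, Finset.mem_range] at hn
        have hpn : p n := by
          have := hmem k
          simp only [hp]; omega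
        have hn' : Nat.nth p (Nat.count p n) = n := Nat.nth_count hpn
        have hlt : Nat.count p n < k := by
          by_contra! hle
          have := hmono.monotone hle
          omega
        refine ⟨Nat.count p n, ?_, hn'⟩
        simp only [Finset.mem_filter, Finset.mem_range]
        exact ⟨hlt, by rw [ih _ (by omega), hn', hn.2]⟩
    rw [walk_succ, hcount, hk]
    have hstep : A (Nat.nth p k + 1) =
        A (Nat.nth p k) + arrowStep (η (A (Nat.nth p k), prevVisits A (Nat.nth p k))) := by
      rw [hA, walk_succ]; rfl
    rw [← hstep]
    have hkk : Nat.nth p k < Nat.nth p (k + 1) := hmono (by omega)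
    have hbetween : ∀ n, Nat.nth p k < n → n < Nat.nth p (k + 1) → A n < m := fun n h1 h2 =>
      hlow (k + 1) n (fun j hj => (hmono.monotone (show j ≤ k by omega)).trans_lt h1) h2
    have h1 := hmem k
    have h2 := hmem (k + 1)
    rcases eq_or_lt_of_le (Nat.succ_le_of_lt hkk) with heq | hlt
    · rw [← heq] at h2 ⊢
      exact max_eq_right h2
    · have h3 := hbetween (Nat.nth p k + 1) (by omega) hlt
      rw [max_eq_left h3.le]
      obtain ⟨t, ht⟩ : ∃ t, Nat.nth p (k + 1) = t + 1 := ⟨Nat.nth p (k + 1) - 1, by omega⟩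
      have h4 := hbetween t (by omega) (by omega)
      have := hf t
      rw [ht] at h2 ⊢
      omega

lemma walk_mem_rset_iff_walk_max {x m : ℤ} {η : ℤ × ℕ → Bool} (hx : x ≤ m)
    (hu : UnboundedPath (walk id x η)) :
    walk id x η ∈ Rset m ↔ walk (max m) m η ∈ Rset m := by
  have hf := isNNPath_walk x η
  have hinf : (Set.ofPred fun n => m ≤ walk id x η n).Infinite := by
    rw [Set.infinite_iff_exists_gt]
    intro N
    obtain ⟨n, hn, hz⟩ := hf.frequently_ge hu m (N + 1)
    exact ⟨n, hz, by omega⟩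
  have hmono := Nat.nth_strictMono hinf
  have key := walk_max_eq_nth hx hu
  constructor
  · intro h N
    obtain ⟨n, hn, hm⟩ := h (Nat.nth (fun n => m ≤ walk id x η n) N)
    have hn' := Nat.nth_count (p := fun n => m ≤ walk id x η n) hm.ge
    refine ⟨Nat.count (fun n => m ≤ walk id x η n) n, ?_, by rw [key, hn', hm]⟩
    rw [← hn'] at hn
    exact hmono.le_iff_le.1 hn
  · intro h N
    obtain ⟨n, hn, hm⟩ := h N
    exact ⟨_, hn.trans (hmono.id_le n), by rw [← key, hm]⟩

lemma walk_max_ge (m : ℤ) (η : ℤ × ℕ → Bool) (n : ℕ) : m ≤ walk (max m) m η n := by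
  cases n with
  | zero => exact le_rfl
  | succ n => rw [walk_succ]; exact le_max_left _ _

lemma walkState_max_congr {m : ℤ} {η η' : ℤ × ℕ → Bool} (h : ∀ z i, m ≤ z → η (z, i) = η' (z, i))
    (n : ℕ) : walkState (max m) m η n = walkState (max m) m η' n := by
  induction n with
  | zero => rfl
  | succ n ih =>
    have hge : m ≤ (walkState (max m) m η' n).1 := walk_max_ge m η' n
    simp only [walkState, ih]
    rw [h _ _ hge]

lemma measurable_arrow_eval {Ω : Type*} [MeasurableSpace Ω] {H : Ω → ℤ × ℕ → Bool}
    (hH : Measurable H) {g : Ω → ℤ × ℕ} (hg : Measurable g) :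
    Measurable fun a => H a (g a) := by
  have : Measurable fun q : (ℤ × ℕ → Bool) × (ℤ × ℕ) => q.1 q.2 :=
    measurable_from_prod_countable_left fun y => measurable_pi_apply y
  exact this.comp (hH.prodMk hg)

lemma measurable_walkState (r : ℤ → ℤ) (x : ℤ) (n : ℕ) :
    Measurable fun η => walkState r x η n := by
  induction n with
  | zero => exact measurable_const
  | succ n ih =>
    have h1 : Measurable fun η => (walkState r x η n).1 := measurable_fst.comp ih
    have h2 : Measurable fun η => (walkState r x η n).2 (walkState r x η n).1 := by
      have : Measurable fun q : (ℤ → ℕ) × ℤ => q.1 q.2 :=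
        measurable_from_prod_countable_left fun y => measurable_pi_apply y
      exact this.comp ((measurable_snd.comp ih).prodMk h1)
    have h3 : Measurable fun η : ℤ × ℕ → Bool =>
        η ((walkState r x η n).1, (walkState r x η n).2 (walkState r x η n).1) :=
      measurable_arrow_eval measurable_id (h1.prodMk h2)
    refine Measurable.prodMk ?_ ?_
    · exact (measurable_of_countable r).comp
        (h1.add ((measurable_of_countable arrowStep).comp h3))
    · refine measurable_pi_iff.2 fun z => ?_
      have h4 : Measurable fun η => (walkState r x η n).2 z :=
        (measurable_pi_apply z).comp (measurable_snd.comp ih)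
      have h5 : MeasurableSet {η | (walkState r x η n).1 = z} :=
        h1 (measurableSet_singleton z)
      have h6 : (fun η => (walkState r x η (n + 1)).2 z) = fun η =>
          if (walkState r x η n).1 = z then (walkState r x η n).2 (walkState r x η n).1 + 1
          else (walkState r x η n).2 z := by
        ext η
        simp only [walkState, Function.update_apply, eq_comm]
      exact h6 ▸ Measurable.ite h5 (h2.add_const 1) h4

lemma measurable_walk (r : ℤ → ℤ) (x : ℤ) : Measurable (walk r x) :=
  measurable_pi_iff.2 fun n => measurable_fst.comp (measurable_walkState r x n)

lemma measurableSet_eval_eq (n : ℕ) (y : ℤ) : MeasurableSet {Y : ℕ → ℤ | Y n = y} :=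
  measurableSet_eq_fun (measurable_pi_apply n) measurable_const

lemma measurableSet_cylinder (x : ℕ → ℤ) (n : ℕ) :
    MeasurableSet {Y : ℕ → ℤ | ∀ m ≤ n, Y m = x m} := by
  have : {Y : ℕ → ℤ | ∀ m ≤ n, Y m = x m} = ⋂ m : ℕ, ⋂ _ : m ≤ n, {Y | Y m = x m} := by
    ext; simp
  rw [this]
  exact MeasurableSet.iInter fun m => MeasurableSet.iInter fun _ => measurableSet_eval_eq m _

lemma measurableSet_rset (y : ℤ) : MeasurableSet (Rset y) := by
  have : Rset y = ⋂ N : ℕ, ⋃ n : ℕ, ⋃ _ : n ≥ N, {Y : ℕ → ℤ | Y n = y} := by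
    ext Y; simp [Rset]
  rw [this]
  exact MeasurableSet.iInter fun N => MeasurableSet.iUnion fun n => MeasurableSet.iUnion fun _ =>
    measurableSet_eval_eq n y

/-- The law of an arrow which points to the right with probability `q`. -/
def coin (q : unitInterval) : Measure Bool :=
  ENNReal.ofReal q • Measure.dirac true + ENNReal.ofReal (1 - q) • Measure.dirac false

instance (q : unitInterval) : IsProbabilityMeasure (coin q) := by
  constructor
  simp only [coin, Measure.coe_add, Measure.coe_smul, Pi.add_apply, Pi.smul_apply, measure_univ,
    smul_eq_mul, mul_one]
  rw [← ENNReal.ofReal_add q.2.1 (by linarith [q.2.2])]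
  simp

lemma coin_apply (q : unitInterval) (s : Set Bool) [Decidable (true ∈ s)] [Decidable (false ∈ s)] :
    coin q s = (if true ∈ s then ENNReal.ofReal q else 0) +
      if false ∈ s then ENNReal.ofReal (1 - q) else 0 := by
  simp [coin, Set.indicator_apply]

/-- The strength of the `i`-th cookie at `z` as an element of the unit interval. -/
def cookieProb {ω : CEnv} (hω : IsCookieEnv ω) (k : ℤ × ℕ) : unitInterval :=
  ⟨ω k.1 k.2, by linarith [(hω k.1 k.2).1], (hω k.1 k.2).2⟩

/-- The law of the independent arrow stacks associated with `ω`. -/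
def arrowLaw {ω : CEnv} (hω : IsCookieEnv ω) : Measure (ℤ × ℕ → Bool) :=
  Measure.infinitePi fun k => coin (cookieProb hω k)

instance {ω : CEnv} (hω : IsCookieEnv ω) : IsProbabilityMeasure (arrowLaw hω) := by
  unfold arrowLaw; infer_instance

lemma arrowLaw_eval {ω : CEnv} (hω : IsCookieEnv ω) (k : ℤ × ℕ) (s : Set Bool) :
    arrowLaw hω {η | η k ∈ s} = coin (cookieProb hω k) s := by
  rw [← Measure.infinitePi_map_eval (fun k => coin (cookieProb hω k)) k,
    Measure.map_apply (measurable_pi_apply k) (MeasurableSet.of_discrete)]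
  rfl

lemma iIndepFun_arrows {ω : CEnv} (hω : IsCookieEnv ω) :
    iIndepFun (fun k (η : ℤ × ℕ → Bool) => η k) (arrowLaw hω) :=
  iIndepFun_infinitePi (X := fun _ b => b) fun _ => measurable_id

lemma prevVisits_congr {f g : ℕ → ℤ} {n : ℕ} (h : ∀ m ≤ n, f m = g m) :
    prevVisits f n = prevVisits g n := by
  unfold prevVisits
  rw [h n le_rfl]
  congr 1
  exact Finset.filter_congr fun m hm => by rw [h m (Finset.mem_range.1 hm).le]

lemma walk_eq_upto_iff (x0 : ℤ) (η : ℤ × ℕ → Bool) (x : ℕ → ℤ) (n : ℕ) :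
    (∀ m ≤ n, walk id x0 η m = x m) ↔
      x 0 = x0 ∧ ∀ m < n, x (m + 1) = x m + arrowStep (η (x m, prevVisits x m)) := by
  induction n with
  | zero => simp [walk_zero, eq_comm]
  | succ n ih =>
    have hstep (h : ∀ m ≤ n, walk id x0 η m = x m) :
        walk id x0 η (n + 1) = x n + arrowStep (η (x n, prevVisits x n)) := by
      rw [walk_succ, prevVisits_congr h, h n le_rfl, id]
    constructor
    · intro h
      have h' : ∀ m ≤ n, walk id x0 η m = x m := fun m hm => h m (by omega)
      refine ⟨(ih.1 h').1, fun m hm => ?_⟩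
      rcases Nat.lt_succ_iff_lt_or_eq.1 hm with hm | rfl
      · exact (ih.1 h').2 m hm
      · rw [← hstep h', h _ le_rfl]
    · rintro ⟨h0, h⟩
      have h' := ih.2 ⟨h0, fun m hm => h m (by omega)⟩
      intro m hm
      rcases Nat.le_succ_iff.1 hm with hm | rfl
      · exact h' m hm
      · rw [hstep h', h n (by omega)]

lemma injective_visitIndex (x : ℕ → ℤ) : Function.Injective fun n => (x n, prevVisits x n) := by
  have key : ∀ a b, a < b → x a = x b → prevVisits x a < prevVisits x b := by
    intro a b hab hx
    rw [prevVisits_eq_count, prevVisits_eq_count, hx]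
    calc _ < Nat.count (fun m => x m = x b) (a + 1) := by
          rw [Nat.count_succ, if_pos hx]; omega
      _ ≤ _ := Nat.count_monotone _ hab
  intro a b h
  simp only [Prod.mk.injEq] at h
  rcases lt_trichotomy a b with hab | hab | hab
  · have := key a b hab h.1; omega
  · exact hab
  · have := key b a hab h.1.symm; omega

lemma coin_step {ω : CEnv} (hω : IsCookieEnv ω) (x : ℕ → ℤ) (m : ℕ) :
    coin (cookieProb hω (x m, prevVisits x m)) {b | x (m + 1) = x m + arrowStep b} =
      ENNReal.ofReal (stepProb ω x m) := by
  classical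
  rw [coin_apply, stepProb]
  simp only [Set.mem_ofPred_eq, arrowStep, cookieProb, if_true, Bool.false_eq_true, if_false]
  by_cases h1 : x (m + 1) = x m + 1
  · have h2 : ¬ x (m + 1) = x m + -1 := by omega
    simp only [h1] at h2 ⊢
    simp
  · by_cases h2 : x (m + 1) = x m - 1
    · have h3 : x (m + 1) = x m + -1 := by omega
      have h4 : ¬ x m - 1 = x m + 1 := by omega
      simp [h2, h4, ← sub_eq_add_neg]
    · have h3 : ¬ x (m + 1) = x m + -1 := by omega
      simp [h1, h2, h3]

lemma stepProb_nonneg {ω : CEnv} (hω : IsCookieEnv ω) (x : ℕ → ℤ) (m : ℕ) :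
    0 ≤ stepProb ω x m := by
  have := hω (x m) (prevVisits x m)
  unfold stepProb
  split_ifs
  · linarith [this.1]
  · linarith [this.2]
  · exact le_rfl

lemma arrowLaw_cylinder {ω : CEnv} (hω : IsCookieEnv ω) (x0 : ℤ) (x : ℕ → ℤ) (n : ℕ) :
    arrowLaw hω {η | ∀ m ≤ n, walk id x0 η m = x m} = ENNReal.ofReal (cylProb ω x0 x n) := by
  simp only [walk_eq_upto_iff]
  unfold cylProb
  by_cases h0 : x 0 = x0
  · simp only [h0, true_and, if_true, one_mul]
    have hind := (iIndepFun_arrows hω).precomp (injective_visitIndex x)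
    have := hind.measure_inter_preimage_eq_mul (Finset.range n)
      (sets := fun m => {b | x (m + 1) = x m + arrowStep b}) fun _ _ => MeasurableSet.of_discrete
    rw [ENNReal.ofReal_prod_of_nonneg fun m _ => stepProb_nonneg hω x m]
    calc _ = arrowLaw hω (⋂ m ∈ Finset.range n,
          ((fun k (η : ℤ × ℕ → Bool) => η k) ∘ fun n => (x n, prevVisits x n)) m ⁻¹'
            {b | x (m + 1) = x m + arrowStep b}) := by
          congr 1; ext η; simp
      _ = _ := this
      _ = _ := Finset.prod_congr rfl fun m _ => by
          rw [← coin_step hω, ← arrowLaw_eval]; rfl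
  · simp [h0]

lemma isERWLaw_map_walk {ω : CEnv} (hω : IsCookieEnv ω) (x0 : ℤ) :
    IsERWLaw ω x0 ((arrowLaw hω).map (walk id x0)) := by
  refine ⟨Measure.isProbabilityMeasure_map (measurable_walk id x0).aemeasurable, fun x n => ?_⟩
  rw [Measure.map_apply (measurable_walk id x0) (measurableSet_cylinder x n),
    ← arrowLaw_cylinder hω]
  rfl

/-- The sets of paths with a prescribed initial segment. -/
def cylinderSets : Set (Set (ℕ → ℤ)) := {s | ∃ (x : ℕ → ℤ) (n : ℕ), s = {Y | ∀ m ≤ n, Y m = x m}}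

lemma isPiSystem_cylinderSets : IsPiSystem cylinderSets := by
  rintro _ ⟨x, n, rfl⟩ _ ⟨x', n', rfl⟩ ⟨Y, hY, hY'⟩
  refine ⟨Y, max n n', ?_⟩
  ext Z
  simp only [Set.mem_inter_iff, Set.mem_ofPred_eq] at hY hY' ⊢
  constructor
  · rintro ⟨h, h'⟩ m hm
    rcases le_max_iff.1 hm with hm | hm
    · rw [h m hm, hY m hm]
    · rw [h' m hm, hY' m hm]
  · intro h
    exact ⟨fun m hm => by rw [h m (by omega), hY m hm], fun m hm => by rw [h m (by omega), hY' m hm]⟩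

lemma generateFrom_cylinderSets :
    (inferInstance : MeasurableSpace (ℕ → ℤ)) = MeasurableSpace.generateFrom cylinderSets := by
  apply le_antisymm
  · refine iSup_le fun n => ?_
    rw [MeasurableSpace.comap_le_iff_le_map]
    intro s _
    have : (fun Y : ℕ → ℤ => Y n) ⁻¹' s = ⋃ h : {h : Fin (n + 1) → ℤ // h (Fin.last n) ∈ s},
        {Y : ℕ → ℤ | ∀ m ≤ n, Y m = if hm : m < n + 1 then h.1 ⟨m, hm⟩ else 0} := by
      ext Y
      simp only [Set.mem_preimage, Set.mem_iUnion, Set.mem_ofPred_eq]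
      constructor
      · intro hY
        refine ⟨⟨fun i => Y i, hY⟩, fun m hm => ?_⟩
        rw [dif_pos (by omega)]
      · rintro ⟨h, hY⟩
        rw [hY n le_rfl, dif_pos (by omega)]
        exact h.2
    change MeasurableSet[MeasurableSpace.generateFrom cylinderSets] _
    rw [this]
    exact MeasurableSet.iUnion fun h => MeasurableSpace.measurableSet_generateFrom ⟨_, n, rfl⟩
  · refine MeasurableSpace.generateFrom_le ?_
    rintro _ ⟨x, n, rfl⟩
    exact measurableSet_cylinder x n

lemma IsERWLaw.unique {ω : CEnv} {x0 : ℤ} {P Q : Measure (ℕ → ℤ)} (hP : IsERWLaw ω x0 P)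
    (hQ : IsERWLaw ω x0 Q) : P = Q := by
  have := hP.1
  have := hQ.1
  refine ext_of_generate_finite cylinderSets generateFrom_cylinderSets isPiSystem_cylinderSets ?_
    (by simp)
  rintro _ ⟨x, n, rfl⟩
  rw [hP.2, hQ.2]

/-- The initial segment of the walk up to time `n`. -/
def walkHist (x : ℤ) (n : ℕ) (η : ℤ × ℕ → Bool) (i : Set.Iic n) : ℤ := walk id x η i

lemma measurable_walkHist (x : ℤ) (n : ℕ) : Measurable (walkHist x n) :=
  measurable_pi_iff.2 fun i => (measurable_pi_apply (i : ℕ)).comp (measurable_walk id x)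

/-- The filtration generated by the walk. -/
def walkFiltration (x : ℤ) :
    Filtration ℕ (inferInstance : MeasurableSpace (ℤ × ℕ → Bool)) where
  seq n := MeasurableSpace.comap (walkHist x n) inferInstance
  mono' i j hij := by
    have h : walkHist x i =
        (fun (h : Set.Iic j → ℤ) (k : Set.Iic i) => h ⟨k, k.2.trans hij⟩) ∘ walkHist x j := rfl
    have hm : Measurable (fun (h : Set.Iic j → ℤ) (k : Set.Iic i) => h ⟨k, k.2.trans hij⟩) :=
      measurable_pi_iff.2 fun k => measurable_pi_apply _
    simp only
    rw [h, ← MeasurableSpace.comap_comp]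
    exact MeasurableSpace.comap_mono hm.comap_le
  le' n := (measurable_walkHist x n).comap_le

lemma measurableSet_walk_up (x : ℤ) (n : ℕ) :
    MeasurableSet {η | walk id x η (n + 1) = walk id x η n + 1} :=
  measurableSet_eq_fun ((measurable_pi_apply (n + 1)).comp (measurable_walk id x))
    (((measurable_pi_apply n).comp (measurable_walk id x)).add_const 1)

lemma arrowLaw_walkHist_le {ω : CEnv} (hω : IsCookieEnv ω) (x : ℤ) (n : ℕ)
    (B : Set (Set.Iic n → ℤ)) :
    arrowLaw hω (walkHist x n ⁻¹' B) ≤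
      2 * arrowLaw hω (walkHist x n ⁻¹' B ∩ {η | walk id x η (n + 1) = walk id x η n + 1}) := by
  have hU := measurableSet_walk_up x n
  have hH := measurable_walkHist x n
  have hB : MeasurableSet B := B.to_countable.measurableSet
  set U := {η | walk id x η (n + 1) = walk id x η n + 1} with hUdef
  have e1 : arrowLaw hω (walkHist x n ⁻¹' B) = (arrowLaw hω).map (walkHist x n) B :=
    (Measure.map_apply hH hB).symm
  have e2 : arrowLaw hω (walkHist x n ⁻¹' B ∩ U) =
      ((arrowLaw hω).restrict U).map (walkHist x n) B := by
    rw [Measure.map_apply hH hB, Measure.restrict_apply (hH hB)]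
  rw [e1, e2, ← Measure.tsum_indicator_apply_singleton _ B hB,
    ← Measure.tsum_indicator_apply_singleton _ B hB, ← ENNReal.tsum_mul_left]
  refine ENNReal.tsum_le_tsum fun h => ?_
  by_cases hh : h ∈ B
  swap
  · simp [hh]
  rw [Set.indicator_of_mem hh, Set.indicator_of_mem hh,
    Measure.map_apply hH (measurableSet_singleton h),
    Measure.map_apply hH (measurableSet_singleton h),
    Measure.restrict_apply (hH (measurableSet_singleton h))]
  set p : ℕ → ℤ := fun m => if hm : m ≤ n then h ⟨m, hm⟩ else h ⟨n, Set.mem_Iic.2 le_rfl⟩ + 1 with hp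
  have hpn : p n = h ⟨n, Set.mem_Iic.2 le_rfl⟩ := by simp [hp]
  have hpn' : p (n + 1) = p n + 1 := by simp [hp]
  have s1 : walkHist x n ⁻¹' {h} = {η | ∀ m ≤ n, walk id x η m = p m} := by
    ext η
    simp only [Set.mem_preimage, Set.mem_singleton_iff, Set.mem_ofPred_eq]
    constructor
    · intro hη m hm
      have := congrFun hη ⟨m, hm⟩
      simp only [hp, dif_pos hm]
      exact this
    · intro hη
      ext ⟨i, hi⟩
      have hi' : i ≤ n := hi
      have := hη i hi'
      simp only [hp, dif_pos hi'] at this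
      exact this
  have s2 : walkHist x n ⁻¹' {h} ∩ U = {η | ∀ m ≤ n + 1, walk id x η m = p m} := by
    rw [s1]
    ext η
    simp only [hUdef, Set.mem_inter_iff, Set.mem_ofPred_eq]
    constructor
    · rintro ⟨h1, h2⟩ m hm
      rcases Nat.le_succ_iff.1 hm with hm | rfl
      · exact h1 m hm
      · rw [h2, h1 n le_rfl]; exact hpn'.symm
    · intro h1
      exact ⟨fun m hm => h1 m (by omega), by rw [h1 _ le_rfl, h1 n (by omega), hpn']⟩
  rw [s2, s1, arrowLaw_cylinder, arrowLaw_cylinder, ← ENNReal.ofReal_ofNat 2,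
    ← ENNReal.ofReal_mul (by norm_num)]
  refine ENNReal.ofReal_le_ofReal ?_
  have hc : 0 ≤ cylProb ω x p n := by
    unfold cylProb
    refine mul_nonneg (by split_ifs <;> norm_num) ?_
    exact Finset.prod_nonneg fun m _ => stepProb_nonneg hω p m
  have hs : cylProb ω x p (n + 1) = cylProb ω x p n * ω (p n) (prevVisits p n) := by
    unfold cylProb
    rw [Finset.prod_range_succ, ← mul_assoc]
    congr 1
    simp [stepProb, hpn']
  rw [hs]
  nlinarith [(hω (p n) (prevVisits p n)).1]

open Classical in
/-- The position relative to `m` of the walk stopped upon hitting `m`. -/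
def stoppedWalk (x m : ℤ) (n : ℕ) (η : ℤ × ℕ → Bool) : ℝ :=
  if ∃ j ≤ n, walk id x η j = m then 0 else (walk id x η n : ℝ) - m

/-- The event that the walk has not hit `m` up to time `n`. -/
def notHit (x m : ℤ) (n : ℕ) : Set (ℤ × ℕ → Bool) := {η | ¬ ∃ j ≤ n, walk id x η j = m}

lemma notHit_eq (x m : ℤ) (n : ℕ) :
    notHit x m n = walkHist x n ⁻¹' {h | ¬ ∃ j, h j = m} := by
  ext η
  simp [notHit, walkHist]

open Classical in
lemma stoppedWalk_eq_comp (x m : ℤ) (n : ℕ) :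
    stoppedWalk x m n = (fun h : Set.Iic n → ℤ =>
      if ∃ j, h j = m then (0 : ℝ) else (h ⟨n, Set.mem_Iic.2 le_rfl⟩ : ℝ) - m) ∘ walkHist x n := by
  ext η
  simp [stoppedWalk, walkHist]

lemma stronglyAdapted_stoppedWalk (x m : ℤ) :
    StronglyAdapted (walkFiltration x) (stoppedWalk x m) := by
  intro n
  rw [stoppedWalk_eq_comp]
  exact ((measurable_of_countable _).comp (comap_measurable (walkHist x n))).stronglyMeasurable

lemma abs_walk_sub_le (x : ℤ) (η : ℤ × ℕ → Bool) (n : ℕ) : |walk id x η n - x| ≤ n := by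
  induction n with
  | zero => simp [walk_zero]
  | succ n ih =>
    have := walk_id_succ x η n
    push_cast
    rw [abs_le] at *
    omega

lemma integrable_stoppedWalk {ω : CEnv} (hω : IsCookieEnv ω) (x m : ℤ) (n : ℕ) :
    Integrable (stoppedWalk x m n) (arrowLaw hω) := by
  refine Integrable.of_bound (C := n + |(x : ℝ) - m|)
    (((stronglyAdapted_stoppedWalk x m n).mono
      ((walkFiltration x).le n)).aestronglyMeasurable) (ae_of_all _ fun η => ?_)
  have h1 : |(walk id x η n : ℝ) - x| ≤ n := by exact_mod_cast abs_walk_sub_le x η n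
  unfold stoppedWalk
  split_ifs
  · rw [norm_zero]; positivity
  · rw [Real.norm_eq_abs]
    calc |(walk id x η n : ℝ) - m| = |((walk id x η n : ℝ) - x) + (x - m)| := by ring_nf
      _ ≤ _ := (abs_add_le _ _).trans (by linarith)

lemma stoppedWalk_succ_sub (x m : ℤ) (n : ℕ) (η : ℤ × ℕ → Bool) :
    stoppedWalk x m (n + 1) η - stoppedWalk x m n η =
      2 * (notHit x m n ∩ {η | walk id x η (n + 1) = walk id x η n + 1}).indicator 1 η -
        (notHit x m n).indicator 1 η := by
  by_cases h : ∃ j ≤ n, walk id x η j = m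
  · have h' : ∃ j ≤ n + 1, walk id x η j = m := by
      obtain ⟨j, hj, hjm⟩ := h
      exact ⟨j, by omega, hjm⟩
    have hN : η ∉ notHit x m n := fun hn => hn h
    simp [stoppedWalk, h, h', hN]
  · have hN : η ∈ notHit x m n := h
    have e : stoppedWalk x m (n + 1) η = (walk id x η (n + 1) : ℝ) - m := by
      unfold stoppedWalk
      split_ifs with h1
      · obtain ⟨j, hj, hjm⟩ := h1
        rcases Nat.le_succ_iff.1 hj with hj | rfl
        · exact absurd ⟨j, hj, hjm⟩ h
        · simp [← hjm]
      · rfl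
    rw [e, stoppedWalk, if_neg h]
    rcases walk_id_succ x η n with hs | hs
    · simp [hN, hs]
      ring
    · have hs' : ¬ walk id x η n - 1 = walk id x η n + 1 := by omega
      simp [hN, hs, hs']

lemma submartingale_stoppedWalk {ω : CEnv} (hω : IsCookieEnv ω) (x m : ℤ) :
    Submartingale (stoppedWalk x m) (walkFiltration x) (arrowLaw hω) := by
  refine submartingale_of_setIntegral_le_succ (stronglyAdapted_stoppedWalk x m)
    (integrable_stoppedWalk hω x m) fun n A hA => ?_
  have hA' : MeasurableSet A := (walkFiltration x).le n A hA
  have hN : MeasurableSet (notHit x m n) := by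
    rw [notHit_eq]
    exact measurable_walkHist x n (Set.to_countable _).measurableSet
  have hU := measurableSet_walk_up x n
  rw [← sub_nonneg, ← integral_sub (integrable_stoppedWalk hω x m _).integrableOn
    (integrable_stoppedWalk hω x m _).integrableOn]
  simp only [stoppedWalk_succ_sub]
  rw [integral_sub (((integrable_const 1).indicator (hN.inter hU)).const_mul 2)
    ((integrable_const 1).indicator hN), integral_const_mul,
    integral_indicator_one (hN.inter hU), integral_indicator_one hN,
    measureReal_restrict_apply (hN.inter hU), measureReal_restrict_apply hN, sub_nonneg]
  obtain ⟨B, -, rfl⟩ := hA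
  have := arrowLaw_walkHist_le hω x n ({h | ¬ ∃ j, h j = m} ∩ B)
  rw [Set.preimage_inter, ← notHit_eq] at this
  have h2 := ENNReal.toReal_mono (by finiteness) this
  rw [ENNReal.toReal_mul, ENNReal.toReal_ofNat] at h2
  rw [Set.inter_right_comm]
  exact h2

/-- Since no site has a drift to the left, the walk hits every site to its right. -/
lemma ae_exists_walk_eq {ω : CEnv} (hω : IsCookieEnv ω) {x m : ℤ} (hx : x ≤ m) :
    ∀ᵐ η ∂arrowLaw hω, ∃ n, walk id x η n = m := by
  have hsub := submartingale_stoppedWalk hω x m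
  have hneg : ∀ n η, stoppedWalk x m n η ≤ 0 := by
    intro n η
    unfold stoppedWalk
    split_ifs with h
    · exact le_rfl
    · have : walk id x η n ≤ m := by
        by_contra! hlt
        obtain ⟨c, -, hc, hcm⟩ := (isNNPath_walk x η).exists_eq (Nat.zero_le n) hx hlt.le
        exact h ⟨c, hc, hcm⟩
      have : (walk id x η n : ℝ) ≤ m := by exact_mod_cast this
      linarith
  have hbdd : ∀ n, eLpNorm (stoppedWalk x m n) 1 (arrowLaw hω) ≤
      ((∫ η, ‖stoppedWalk x m 0 η‖ ∂arrowLaw hω).toNNReal : NNReal) := by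
    intro n
    rw [eLpNorm_one_eq_lintegral_enorm,
      ← ofReal_integral_norm_eq_lintegral_enorm (integrable_stoppedWalk hω x m n)]
    refine ENNReal.ofReal_le_ofReal ?_
    have habs : ∀ k, ∫ η, ‖stoppedWalk x m k η‖ ∂arrowLaw hω =
        -∫ η, stoppedWalk x m k η ∂arrowLaw hω := by
      intro k
      rw [← integral_neg]
      congr 1
      ext η
      rw [Real.norm_eq_abs, abs_of_nonpos (hneg k η)]
    rw [habs, habs]
    have := hsub.setIntegral_le (Nat.zero_le n) (s := Set.univ) MeasurableSet.univ
    simp only [Measure.restrict_univ] at this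
    linarith
  filter_upwards [hsub.exists_ae_tendsto_of_bdd hbdd] with η hη
  obtain ⟨c, hc⟩ := hη
  by_contra! hno
  have hval : ∀ n, stoppedWalk x m n η = (walk id x η n : ℝ) - m := by
    intro n
    rw [stoppedWalk, if_neg]
    rintro ⟨j, -, hj⟩
    exact hno j hj
  have hdiff := ((tendsto_add_atTop_iff_nat 1).2 hc).sub hc
  rw [sub_self] at hdiff
  obtain ⟨n, hn⟩ := (hdiff.abs.eventually_lt_const (u := 1) (by simp)).exists
  rw [hval, hval] at hn
  rcases walk_id_succ x η n with hs | hs <;> rw [hs] at hn <;> simp at hn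

lemma ae_unboundedPath_walk {ω : CEnv} (hω : IsCookieEnv ω) (x : ℤ) :
    ∀ᵐ η ∂arrowLaw hω, UnboundedPath (walk id x η) := by
  have : ∀ᵐ η ∂arrowLaw hω, ∀ k : ℕ, ∃ n, walk id x η n = x + k :=
    ae_all_iff.2 fun k => ae_exists_walk_eq hω (by omega)
  filter_upwards [this] with η hη m
  obtain ⟨n, hn⟩ := hη (m - x).toNat
  exact ⟨n, by omega⟩

lemma ae_frequently_false {ω : CEnv} (hω : IsCookieEnv ω) (z : ℤ)
    (h : ∑' i : ℕ, ENNReal.ofReal (1 - ω z i) = ∞) :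
    ∀ᵐ η ∂arrowLaw hω, ∃ᶠ i in atTop, η (z, i) = false := by
  classical
  have hmeas (i : ℕ) : MeasurableSet {η : ℤ × ℕ → Bool | η (z, i) ∈ ({false} : Set Bool)} :=
    measurable_pi_apply (z, i) MeasurableSet.of_discrete
  have hind : iIndepSet (fun i : ℕ => {η : ℤ × ℕ → Bool | η (z, i) ∈ ({false} : Set Bool)})
      (arrowLaw hω) := by
    rw [iIndepSet_iff_meas_biInter hmeas]
    intro s
    exact ((iIndepFun_arrows hω).precomp (g := fun i : ℕ => (z, i))
      (Prod.mk_right_injective z)).measure_inter_preimage_eq_mul s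
      (sets := fun _ => {false}) fun _ _ => MeasurableSet.of_discrete
  have hlim := measure_limsup_eq_one hmeas hind (by
    rw [← h]
    refine tsum_congr fun i => ?_
    rw [arrowLaw_eval, coin_apply]
    simp [cookieProb])
  rw [← prob_compl_eq_zero_iff (MeasurableSet.measurableSet_limsup hmeas)] at hlim
  filter_upwards [compl_mem_ae_iff.2 hlim] with η hη
  rw [compl_compl, Filter.mem_limsup_iff_frequently_mem] at hη
  exact hη

lemma ae_not_frequently_false {ω : CEnv} (hω : IsCookieEnv ω) (z : ℤ)
    (h : ∑' i : ℕ, ENNReal.ofReal (1 - ω z i) ≠ ∞) :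
    ∀ᵐ η ∂arrowLaw hω, ¬ ∃ᶠ i in atTop, η (z, i) = false := by
  classical
  have hsum : ∑' i : ℕ, arrowLaw hω {η | η (z, i) ∈ ({false} : Set Bool)} ≠ ∞ := by
    convert h using 3 with i
    rw [arrowLaw_eval, coin_apply]
    simp [cookieProb]
  filter_upwards [ae_eventually_notMem hsum] with η hη
  rw [Filter.not_frequently]
  exact hη

lemma rset_iff_of_frequently {x y m : ℤ} {η : ℤ × ℕ → Bool} (hu : UnboundedPath (walk id x η))
    (hη : ∀ z > y, ∃ᶠ i in atTop, η (z, i) = false) (hym : y ≤ m) :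
    walk id x η ∈ Rset y ↔ walk id x η ∈ Rset m := by
  refine ⟨(isNNPath_walk x η).rset_mono hu hym, ?_⟩
  induction m, hym using Int.leInduction with
  | base => exact id
  | succ m hm ih =>
    intro h
    have := walk_mem_rset_pred h (hη _ (by omega))
    rw [add_sub_cancel_right] at this
    exact ih this

/-- The event that the walk reflected at `m` returns to `m` infinitely often. -/
def reflectedRecurrence (m : ℤ) : Set (ℤ × ℕ → Bool) := {η | walk (max m) m η ∈ Rset m}

/-- The σ-algebra generated by the arrow at `k`. -/
abbrev arrowSigma (k : ℤ × ℕ) : MeasurableSpace (ℤ × ℕ → Bool) :=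
  MeasurableSpace.comap (fun η => η k) inferInstance

lemma measurableSet_reflectedRecurrence {N m : ℤ} (hNm : N ≤ m) :
    MeasurableSet[⨆ k ∈ {k : ℤ × ℕ | N ≤ k.1}, arrowSigma k] (reflectedRecurrence m) := by
  set g : (ℤ × ℕ → Bool) → (ℤ × ℕ → Bool) := fun η k => if m ≤ k.1 then η k else true with hg
  have hgm : Measurable[⨆ k ∈ {k : ℤ × ℕ | N ≤ k.1}, arrowSigma k] g := by
    refine @measurable_pi_lambda _ _ _ (_) _ _ fun k => ?_
    by_cases hk : m ≤ k.1
    · have : (fun η => g η k) = fun η => η k := by ext η; simp [hg, hk]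
      rw [this]
      exact (comap_measurable _).mono
        (le_iSup₂_of_le (f := fun k _ => arrowSigma k) k (hNm.trans hk) le_rfl) le_rfl
    · have : (fun η => g η k) = fun _ => true := by ext η; simp [hg, hk]
      rw [this]
      exact @measurable_const _ _ _ (_) _
  have heq : reflectedRecurrence m = g ⁻¹' (walk (max m) m ⁻¹' Rset m) := by
    ext η
    have : walk (max m) m η = walk (max m) m (g η) := by
      ext n
      unfold walk
      rw [walkState_max_congr (η' := g η)]
      intro z i hz
      simp [hg, hz]
    simp only [reflectedRecurrence, Set.mem_ofPred_eq, Set.mem_preimage]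
    rw [this]
  rw [heq]
  exact hgm (measurable_walk _ _ (measurableSet_rset m))

/-- The event that the walk reflected at `m` is recurrent for arbitrarily large `m`. -/
def tailRecurrence : Set (ℤ × ℕ → Bool) := {η | ∃ᶠ m in (atTop : Filter ℤ), η ∈ reflectedRecurrence m}

lemma measurableSet_tailRecurrence (N : ℤ) :
    MeasurableSet[⨆ k ∈ {k : ℤ × ℕ | N ≤ k.1}, arrowSigma k] tailRecurrence := by
  have : tailRecurrence = ⋂ a : ℤ, ⋃ m : ℤ, ⋃ _ : max a N ≤ m, reflectedRecurrence m := by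
    ext η
    simp only [tailRecurrence, Set.mem_ofPred_eq, Filter.frequently_atTop, Set.mem_iInter,
      Set.mem_iUnion, exists_prop]
    constructor
    · intro h a
      obtain ⟨m, hm, h⟩ := h (max a N)
      exact ⟨m, hm, h⟩
    · intro h a
      obtain ⟨m, hm, h⟩ := h a
      exact ⟨m, (le_max_left _ _).trans hm, h⟩
  rw [this]
  refine @MeasurableSet.iInter _ _ (_) _ _ fun a => ?_
  refine @MeasurableSet.iUnion _ _ (_) _ _ fun m => ?_
  refine @MeasurableSet.iUnion _ _ (_) _ _ fun hm => ?_
  exact measurableSet_reflectedRecurrence ((le_max_right _ _).trans hm)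

lemma arrowLaw_tailRecurrence {ω : CEnv} (hω : IsCookieEnv ω) :
    arrowLaw hω tailRecurrence = 0 ∨ arrowLaw hω tailRecurrence = 1 := by
  refine measure_zero_or_one_of_measurableSet_limsup (s := arrowSigma)
    (p := fun t => ∃ N : ℤ, t = {k | k.1 < N}) (f := comap Prod.fst atTop)
    (ns := fun N : ℤ => {k | k.1 < N})
    (fun k => (measurable_pi_apply k).comap_le) (iIndepFun_arrows hω) ?_ ?_
    (fun N => ⟨N, rfl⟩) (fun k => ⟨k.1 + 1, by simp⟩) ?_
  · rintro _ ⟨N, rfl⟩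
    refine Filter.mem_comap.2 ⟨Set.Ici N, Filter.Ici_mem_atTop N, fun k hk => ?_⟩
    simpa using hk
  · intro a b
    exact ⟨max a b, fun k (hk : k.1 < a) => lt_max_of_lt_left hk,
      fun k (hk : k.1 < b) => lt_max_of_lt_right hk⟩
  · rw [(Filter.atTop_basis.comap Prod.fst).limsup_eq_iInf_iSup]
    simp only [MeasurableSpace.measurableSet_iInf]
    exact fun N _ => measurableSet_tailRecurrence N

lemma mem_rset_iff_tailRecurrence {x y : ℤ} {η : ℤ × ℕ → Bool}
    (hu : UnboundedPath (walk id x η)) (hη : ∀ z > y, ∃ᶠ i in atTop, η (z, i) = false) :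
    walk id x η ∈ Rset y ↔ η ∈ tailRecurrence := by
  have key : ∀ m, max x y ≤ m → (walk id x η ∈ Rset y ↔ η ∈ reflectedRecurrence m) :=
    fun m hm => (rset_iff_of_frequently hu hη ((le_max_right _ _).trans hm)).trans
      (walk_mem_rset_iff_walk_max ((le_max_left _ _).trans hm) hu)
  constructor
  · intro h
    exact ((Filter.eventually_ge_atTop (max x y)).mono fun m hm => (key m hm).1 h).frequently
  · intro h
    obtain ⟨m, hm, h⟩ := Filter.frequently_atTop.1 h (max x y)
    exact (key m hm).2 h

/-- Proposition 5, zero-one law. For any `ω ∈ Ω₊` and `y ∈ ℤ`,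
either `P_{x,ω}[R_y] = 0` for all `x`, or `P_{x,ω}[R_y] = 1` for all `x`. -/
theorem erw_zero_one_law (ω : CEnv) (hω : IsCookieEnv ω) (y : ℤ)
    (P : ℤ → Measure (ℕ → ℤ)) (hP : ∀ x, IsERWLaw ω x (P x)) :
    (∀ x, P x (Rset y) = 0) ∨ (∀ x, P x (Rset y) = 1) := by
  have hlaw (x : ℤ) : P x (Rset y) = arrowLaw hω (walk id x ⁻¹' Rset y) := by
    rw [(hP x).unique (isERWLaw_map_walk hω x),
      Measure.map_apply (measurable_walk id x) (measurableSet_rset y)]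
  by_cases h : ∀ z > y, ∑' i : ℕ, ENNReal.ofReal (1 - ω z i) = ∞
  · have htail (x : ℤ) : P x (Rset y) = arrowLaw hω tailRecurrence := by
      rw [hlaw]
      refine measure_congr ?_
      have hfreq : ∀ᵐ η ∂arrowLaw hω, ∀ z > y, ∃ᶠ i in atTop, η (z, i) = false :=
        ae_all_iff.2 fun z => eventually_imp_distrib_left.2 fun hz => ae_frequently_false hω z (h z hz)
      filter_upwards [ae_unboundedPath_walk hω x, hfreq] with η hu hη
      exact propext (mem_rset_iff_tailRecurrence hu hη)
    simp only [htail, forall_const]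
    exact arrowLaw_tailRecurrence hω
  · push Not at h
    obtain ⟨z, hz, hfin⟩ := h
    refine Or.inl fun x => ?_
    rw [hlaw, measure_eq_zero_iff_ae_notMem]
    filter_upwards [ae_unboundedPath_walk hω x, ae_not_frequently_false hω z hfin] with η hu hη hy
    exact hη (frequently_false_of_mem_rset_pred hu
      ((isNNPath_walk x η).rset_mono hu (by omega) hy))

end
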